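/- Let V = {1, 2, 3, 4}, let P be the path with edge set {{1,2}, {2,3}, {3,4}}, and let M1 = {{1,3}, {2,4}} (a perfect matching edge-disjoint from P). Then there is no partition of the edge set of P into two matchings Y0, Y1 such that for every j in {0, 1} the graph on V with edge set M1 ∪ Yj is an acyclic 2-matching. -/

import Mathlib

/-- A set of edges is a matching: each edge is non-diagonal (joins two distinct
vertices) and no two distinct edges share a vertex. -/
def IsMatchingSet {V : Type*} (M : Finset (Sym2 V)) : Prop :=
  (∀ e ∈ M, ¬ e.IsDiag) ∧
    ∀ e ∈ M, ∀ f ∈ M, e ≠ f → ∀ v : V, v ∈ e → v ∉ f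

/-- A set of edges is a perfect matching: a matching covering every vertex. -/
def IsPerfectMatchingSet {V : Type*} (M : Finset (Sym2 V)) : Prop :=
  IsMatchingSet M ∧ ∀ v : V, ∃ e ∈ M, v ∈ e

/-- A set of edges is a 2-matching: each edge is non-diagonal and every vertex
is incident to at most two of the edges. -/
def IsTwoMatchingSet {V : Type*} [DecidableEq V] (C : Finset (Sym2 V)) : Prop :=
  (∀ e ∈ C, ¬ e.IsDiag) ∧
    ∀ v : V, (C.filter (fun e => v ∈ e)).card ≤ 2

/-- A set of edges is an acyclic 2-matching: a 2-matching whose associated graph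
contains no cycle, i.e. it is a vertex-disjoint union of paths. -/
def IsAcyclicTwoMatchingSet {V : Type*} [DecidableEq V] (C : Finset (Sym2 V)) : Prop :=
  IsTwoMatchingSet C ∧ (SimpleGraph.fromEdgeSet (↑C : Set (Sym2 V))).IsAcyclic

theorem IsMatchingSet.eq_of_mem {V : Type*} {M : Finset (Sym2 V)} (hM : IsMatchingSet M)
    {e f : Sym2 V} (he : e ∈ M) (hf : f ∈ M) {v : V} (hve : v ∈ e) (hvf : v ∈ f) : e = f :=
  by_contra fun h => hM.2 e he f hf h v hve hvf

theorem SimpleGraph.not_isAcyclic_of_four_cycle {V : Type*} {G : SimpleGraph V} {a b c d : V}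
    (hab : G.Adj a b) (hbc : G.Adj b c) (hcd : G.Adj c d) (hda : G.Adj d a)
    (hac : a ≠ c) (hbd : b ≠ d) : ¬ G.IsAcyclic := by
  intro h
  refine h (.cons hab (.cons hbc (.cons hcd (.cons hda .nil)))) ?_
  have := hab.ne
  have := hbc.ne
  have := hcd.ne
  have := hda.ne
  simp [SimpleGraph.Walk.isCycle_def, SimpleGraph.Walk.isTrail_def]
  grind

theorem not_isAcyclicTwoMatchingSet_union {Y : Finset (Sym2 (Fin 4))}
    (h01 : s(0, 1) ∈ Y) (h23 : s(2, 3) ∈ Y) :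
    ¬ IsAcyclicTwoMatchingSet (({s(0, 2), s(1, 3)} : Finset (Sym2 (Fin 4))) ∪ Y) := by
  rintro ⟨-, h⟩
  have adj : ∀ {a b : Fin 4}, s(a, b) ∈ ({s(0, 2), s(1, 3)} : Finset (Sym2 (Fin 4))) ∪ Y → a ≠ b →
      (SimpleGraph.fromEdgeSet
        (↑(({s(0, 2), s(1, 3)} : Finset (Sym2 (Fin 4))) ∪ Y) : Set (Sym2 (Fin 4)))).Adj a b :=
    fun h hne => (SimpleGraph.fromEdgeSet_adj _).2 ⟨Finset.mem_coe.2 h, hne⟩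
  exact SimpleGraph.not_isAcyclic_of_four_cycle (a := 0) (b := 1) (c := 3) (d := 2)
    (adj (Finset.mem_union_right _ h01) (by decide))
    (adj (Finset.mem_union_left _ (by decide)) (by decide))
    (adj (Finset.mem_union_right _ (Sym2.eq_swap ▸ h23)) (by decide))
    (adj (Finset.mem_union_left _ (by decide)) (by decide))
    (by decide) (by decide) h

theorem not_mem_of_middle_mem {Y : Finset (Sym2 (Fin 4))} (hY : IsMatchingSet Y)
    (h12 : s(1, 2) ∈ Y) : s(0, 1) ∉ Y ∧ s(2, 3) ∉ Y :=
  ⟨fun h => absurd (hY.eq_of_mem h h12 (v := 1) (by decide) (by decide)) (by decide),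
    fun h => absurd (hY.eq_of_mem h h12 (v := 2) (by decide) (by decide)) (by decide)⟩

/-- On the vertex set `Fin 4` (vertices `0,1,2,3` standing for `1,2,3,4`),
let `P` be the path with edges `{01, 12, 23}` and `M1 = {02, 13}` (a perfect matching
edge-disjoint from `P`). Then the edge set of `P` admits no partition into two matchings
`Y0, Y1` such that both `M1 ∪ Y0` and `M1 ∪ Y1` are acyclic 2-matchings. -/
theorem stmt6 :
    ¬ ∃ Y0 Y1 : Finset (Sym2 (Fin 4)),
      Disjoint Y0 Y1 ∧
      Y0 ∪ Y1 = ({s(0, 1), s(1, 2), s(2, 3)} : Finset (Sym2 (Fin 4))) ∧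
      IsMatchingSet Y0 ∧ IsMatchingSet Y1 ∧
      IsAcyclicTwoMatchingSet
        (({s(0, 2), s(1, 3)} : Finset (Sym2 (Fin 4))) ∪ Y0) ∧
      IsAcyclicTwoMatchingSet
        (({s(0, 2), s(1, 3)} : Finset (Sym2 (Fin 4))) ∪ Y1) := by
  rintro ⟨Y0, Y1, -, hU, hY0, hY1, h0, h1⟩
  have h01 : s(0, 1) ∈ Y0 ∪ Y1 := hU ▸ by decide
  have h12 : s(1, 2) ∈ Y0 ∪ Y1 := hU ▸ by decide
  have h23 : s(2, 3) ∈ Y0 ∪ Y1 := hU ▸ by decide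
  rw [Finset.mem_union] at h01 h12 h23
  rcases h12 with h | h
  · obtain ⟨ha, hb⟩ := not_mem_of_middle_mem hY0 h
    exact not_isAcyclicTwoMatchingSet_union (h01.resolve_left ha) (h23.resolve_left hb) h1
  · obtain ⟨ha, hb⟩ := not_mem_of_middle_mem hY1 h
    exact not_isAcyclicTwoMatchingSet_union (h01.resolve_right ha) (h23.resolve_right hb) h0
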